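/- arXiv:2210.15240 — 3 statements merged into one kernel-verified Lean document; each statement's English description precedes it below -/
import Mathlib

section
/- Let n ≥ 1, ω = exp(2πi/n), k ∈ {0, 1, …, n−1}, d₁ = gcd(n, k) (interpreted as n when k = 0), d₂ = n/d₁, and let r, s be integers. Let Ā ∈ Mat_{d₂}(ℂ) be the matrix with entries Ā_{i,i+1} = 1 for 1 ≤ i < d₂, Ā_{d₂,1} = ω^{r·d₂}, and all other entries 0, and let B̄ = ω^s · diag(1, ω^k, ω^{2k}, …, ω^{(d₂−1)k}) ∈ Mat_{d₂}(ℂ). Then Ā and B̄ are invertible, Ā^n = Id_{d₂}, B̄^n = Id_{d₂}, and the commutator satisfies Ā^{-1} B̄^{-1} Ā B̄ = ω^k · Id_{d₂}; in particular this commutator is a central element of Mat_{d₂}(ℂ). -/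
open Matrix

/-- The `d₂ × d₂` matrix `Ā` with `Ā_{i,i+1} = 1` for `1 ≤ i < d₂`, `Ā_{d₂,1} = ω^{r·d₂}`,
and all other entries `0` (indices here are `0`-based). -/
noncomputable def heisA (ω : ℂ) (d₂ : ℕ) (r : ℤ) : Matrix (Fin d₂) (Fin d₂) ℂ :=
  Matrix.of fun i j =>
    if (i : ℕ) + 1 = (j : ℕ) then 1
    else if (i : ℕ) = d₂ - 1 ∧ (j : ℕ) = 0 then ω ^ (r * (d₂ : ℤ)) else 0

/-- The `d₂ × d₂` matrix `B̄ = ω^s · diag(1, ω^k, ω^{2k}, …, ω^{(d₂−1)k})`. -/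
noncomputable def heisB (ω : ℂ) (d₂ : ℕ) (k : ℕ) (s : ℤ) : Matrix (Fin d₂) (Fin d₂) ℂ :=
  ω ^ s • Matrix.diagonal fun j : Fin d₂ => ω ^ (k * (j : ℕ))

/-- Left multiplication by `heisA ω d r` shifts the rows of a matrix up by one, the first row
becoming the last one after scaling by `ω ^ (r * d)`. -/
lemma heisA_mul_apply (ω : ℂ) {d : ℕ} (hd : 0 < d) (r : ℤ) (M : Matrix (Fin d) (Fin d) ℂ)
    (i j : Fin d) :
    (heisA ω d r * M) i j =
      if h : (i : ℕ) + 1 < d then M ⟨i + 1, h⟩ j else ω ^ (r * (d : ℤ)) * M ⟨0, hd⟩ j := by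
  rw [Matrix.mul_apply]
  split_ifs with h
  · rw [Finset.sum_eq_single ⟨i + 1, h⟩]
    · simp [heisA]
    · intro l _ hl
      have h₁ : (i : ℕ) + 1 ≠ l := fun e => hl (Fin.ext e.symm)
      have h₂ : (i : ℕ) ≠ d - 1 := by omega
      simp [heisA, h₁, h₂]
    · simp
  · have hi : (i : ℕ) = d - 1 := by omega
    rw [Finset.sum_eq_single ⟨0, hd⟩]
    · simp [heisA, hi]
    · intro l _ hl
      have h₁ : (i : ℕ) + 1 ≠ l := by omega
      have h₂ : (l : ℕ) ≠ 0 := fun e => hl (Fin.ext e)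
      simp only [heisA, Matrix.of_apply, if_neg h₁, h₂, and_false, if_false, zero_mul]
    · simp

lemma heisA_pow_apply (ω : ℂ) {d : ℕ} (r : ℤ) {m : ℕ} (hm : m ≤ d) (i j : Fin d) :
    (heisA ω d r ^ m) i j =
      if (i : ℕ) + m = j then 1 else if (i : ℕ) + m = j + d then ω ^ (r * (d : ℤ)) else 0 := by
  induction m generalizing i with
  | zero =>
    have h : (i : ℕ) ≠ j + d := by omega
    simp [Matrix.one_apply, Fin.ext_iff, h]
  | succ m ih =>
    have hd : 0 < d := i.pos
    rw [pow_succ', heisA_mul_apply ω hd]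
    split_ifs with h <;> rw [ih (by omega)] <;> dsimp only <;> split_ifs <;>
      first | omega | simp

/-- The `d`-th power of the weighted cyclic shift is scalar. -/
lemma heisA_pow_self (ω : ℂ) (d : ℕ) (r : ℤ) :
    heisA ω d r ^ d = ω ^ (r * (d : ℤ)) • (1 : Matrix (Fin d) (Fin d) ℂ) := by
  ext i j
  have h : (i : ℕ) + d ≠ j := by omega
  simp [heisA_pow_apply ω r le_rfl, h, Matrix.one_apply, Fin.ext_iff]

lemma heisA_pow_eq_one {ω : ℂ} {n d : ℕ} (hω : ω ^ n = 1) (hd : d ∣ n) (r : ℤ) :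
    heisA ω d r ^ n = 1 := by
  obtain ⟨e, rfl⟩ := hd
  have h : (ω ^ (r * (d : ℤ))) ^ e = 1 := by
    rw [← zpow_natCast, ← _root_.zpow_mul, mul_assoc, mul_comm, _root_.zpow_mul,
      ← Nat.cast_mul, zpow_natCast, hω,
      _root_.one_zpow]
  rw [pow_mul, heisA_pow_self, smul_pow, h, one_pow, one_smul]

lemma heisB_pow_eq_one {ω : ℂ} {n : ℕ} (hω : ω ^ n = 1) (d k : ℕ) (s : ℤ) :
    heisB ω d k s ^ n = 1 := by
  have h : (ω ^ s) ^ n = 1 := by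
    rw [← zpow_natCast, ← _root_.zpow_mul, mul_comm, _root_.zpow_mul, zpow_natCast, hω,
      _root_.one_zpow]
  rw [heisB, smul_pow, h, one_smul, Matrix.diagonal_pow, ← Matrix.diagonal_one]
  congr 1
  ext j
  rw [Pi.pow_apply, ← pow_mul, mul_comm, pow_mul, hω, one_pow]

lemma heisA_mul_heisB {ω : ℂ} {d k : ℕ} (hω : ω ^ (k * d) = 1) (r s : ℤ) :
    heisA ω d r * heisB ω d k s = ω ^ k • (heisB ω d k s * heisA ω d r) := by
  ext i j
  simp only [heisB, Matrix.mul_smul, Matrix.smul_mul, Matrix.smul_apply, smul_eq_mul,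
    Matrix.mul_diagonal, Matrix.diagonal_mul]
  suffices h : heisA ω d r i j * ω ^ (k * (j : ℕ)) =
      ω ^ (k * ((i : ℕ) + 1)) * heisA ω d r i j by
    rw [h]
    ring
  simp only [heisA, Matrix.of_apply]
  split_ifs with h₁ h₂
  · rw [h₁, mul_comm]
  · have hi : (i : ℕ) + 1 = d := by omega
    rw [hi, hω, h₂.2, mul_zero, pow_zero, mul_comm]
  · simp

/-- Let `n ≥ 1`, `ω = exp(2πi/n)`, `k ∈ {0, …, n−1}`,
`d₁ = gcd(n, k)` (equal to `n` when `k = 0`), `d₂ = n/d₁`, and let `r, s ∈ ℤ`.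
With `Ā = heisA ω d₂ r` and `B̄ = heisB ω d₂ k s`: `Ā` and `B̄` are invertible,
`Ā^n = Id`, `B̄^n = Id`, the commutator satisfies `Ā⁻¹B̄⁻¹ĀB̄ = ω^k·Id`, and in
particular this commutator is a central element of `Mat_{d₂}(ℂ)`. -/
theorem heis_commutator_scalar (n : ℕ) (hn : 1 ≤ n) (k : ℕ) (hk : k < n) (r s : ℤ) :
    IsUnit (heisA (Complex.exp (2 * Real.pi * Complex.I / n)) (n / Nat.gcd n k) r) ∧
    IsUnit (heisB (Complex.exp (2 * Real.pi * Complex.I / n)) (n / Nat.gcd n k) k s) ∧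
    heisA (Complex.exp (2 * Real.pi * Complex.I / n)) (n / Nat.gcd n k) r ^ n = 1 ∧
    heisB (Complex.exp (2 * Real.pi * Complex.I / n)) (n / Nat.gcd n k) k s ^ n = 1 ∧
    (heisA (Complex.exp (2 * Real.pi * Complex.I / n)) (n / Nat.gcd n k) r)⁻¹ *
        (heisB (Complex.exp (2 * Real.pi * Complex.I / n)) (n / Nat.gcd n k) k s)⁻¹ *
        heisA (Complex.exp (2 * Real.pi * Complex.I / n)) (n / Nat.gcd n k) r *
        heisB (Complex.exp (2 * Real.pi * Complex.I / n)) (n / Nat.gcd n k) k s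
      = Complex.exp (2 * Real.pi * Complex.I / n) ^ k •
          (1 : Matrix (Fin (n / Nat.gcd n k)) (Fin (n / Nat.gcd n k)) ℂ) ∧
    ∀ M : Matrix (Fin (n / Nat.gcd n k)) (Fin (n / Nat.gcd n k)) ℂ,
      Commute
        ((heisA (Complex.exp (2 * Real.pi * Complex.I / n)) (n / Nat.gcd n k) r)⁻¹ *
          (heisB (Complex.exp (2 * Real.pi * Complex.I / n)) (n / Nat.gcd n k) k s)⁻¹ *
          heisA (Complex.exp (2 * Real.pi * Complex.I / n)) (n / Nat.gcd n k) r *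
          heisB (Complex.exp (2 * Real.pi * Complex.I / n)) (n / Nat.gcd n k) k s) M := by
  set ω : ℂ := Complex.exp (2 * Real.pi * Complex.I / n)
  set d := n / Nat.gcd n k
  have hω : ω ^ n = 1 := (Complex.isPrimitiveRoot_exp n (by omega)).pow_eq_one
  have hd : d ∣ n := Nat.div_dvd_of_dvd (Nat.gcd_dvd_left n k)
  have hkd : ω ^ (k * d) = 1 := by
    have h : n ∣ k * d := by
      rw [← Nat.mul_div_assoc k (Nat.gcd_dvd_left n k), mul_comm,
        Nat.mul_div_assoc n (Nat.gcd_dvd_right n k)]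
      exact dvd_mul_right _ _
    obtain ⟨e, he⟩ := h
    rw [he, pow_mul, hω, one_pow]
  have hAn : heisA ω d r ^ n = 1 := heisA_pow_eq_one hω hd r
  have hBn : heisB ω d k s ^ n = 1 := heisB_pow_eq_one hω d k s
  have hA : IsUnit (heisA ω d r) := IsUnit.of_pow_eq_one hAn (by omega)
  have hB : IsUnit (heisB ω d k s) := IsUnit.of_pow_eq_one hBn (by omega)
  have hcomm : (heisA ω d r)⁻¹ * (heisB ω d k s)⁻¹ * heisA ω d r * heisB ω d k s =
      ω ^ k • (1 : Matrix (Fin d) (Fin d) ℂ) := by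
    rw [mul_assoc, heisA_mul_heisB hkd, Matrix.mul_smul, mul_assoc,
      Matrix.nonsing_inv_mul_cancel_left _ _ ((Matrix.isUnit_iff_isUnit_det _).mp hB),
      Matrix.nonsing_inv_mul _ ((Matrix.isUnit_iff_isUnit_det _).mp hA)]
  refine ⟨hA, hB, hAn, hBn, hcomm, fun M => ?_⟩
  rw [hcomm]
  exact (Commute.one_left M).smul_left _
end

section
/- Let n ≥ 1 be odd, ω = exp(2πi/n), k ∈ {0, 1, …, n−1}, d₁ = gcd(n, k) (interpreted as n when k = 0), d₂ = n/d₁, and let r, s be integers. Let Ā ∈ Mat_{d₂}(ℂ) be the matrix with entries Ā_{i,i+1} = 1 for 1 ≤ i < d₂, Ā_{d₂,1} = ω^{r·d₂}, and all other entries 0, and let B̄ = ω^s · diag(1, ω^k, ω^{2k}, …, ω^{(d₂−1)k}) ∈ Mat_{d₂}(ℂ). Then (Ā − B̄)^n = −(ω^{(s−r)·d₂} − 1)^{d₁} · Id_{d₂}; in particular (Ā − B̄)^n is a scalar multiple of the identity matrix. -/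
open Matrix

open Polynomial in
/-- If the rows of `M + b m` are the standard basis vectors in cyclic order, up to a factor `c` at
the wrap-around, then `∏ (M + b m) = c`. -/
theorem aeval_prod_X_add_C_eq_smul_one {R : Type*} [CommRing R] {e : ℕ}
    (M : Matrix (Fin (e + 1)) (Fin (e + 1)) R) (b : ℕ → R) (c : R)
    (hsucc : ∀ m (h : m < e), Pi.single ⟨m, by omega⟩ 1 ᵥ* (M + algebraMap R _ (b m)) =
      Pi.single ⟨m + 1, by omega⟩ 1)
    (hlast : Pi.single (Fin.last e) 1 ᵥ* (M + algebraMap R _ (b e)) = c • Pi.single 0 1) :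
    aeval M (∏ m ∈ Finset.range (e + 1), (X + C (b m))) = c • 1 := by
  have hrow : ∀ m (h : m < e + 1),
      Pi.single 0 1 ᵥ* aeval M (∏ j ∈ Finset.range m, (X + C (b j))) = Pi.single ⟨m, h⟩ 1 := by
    intro m
    induction m with
    | zero => intro h; simp
    | succ m ih =>
      intro h
      rw [Finset.prod_range_succ, map_mul, ← vecMul_vecMul, ih (by omega), ← hsucc m (by omega)]
      simp
  have hzero : Pi.single 0 1 ᵥ* aeval M (∏ j ∈ Finset.range (e + 1), (X + C (b j))) =
      c • Pi.single 0 1 := by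
    rw [Finset.prod_range_succ, map_mul, ← vecMul_vecMul, hrow e (by omega), ← hlast]
    simp [Fin.last]
  refine Matrix.ext_row fun i => ?_
  rw [← single_one_vecMul, ← single_one_vecMul, ← hrow i i.2, vecMul_vecMul, ← map_mul, mul_comm,
    map_mul, ← vecMul_vecMul, hzero, smul_vecMul, vecMul_smul, vecMul_one]

open Polynomial in
theorem IsPrimitiveRoot.prod_X_add_C_eq {K : Type*} [Field K] {d : ℕ} {q : K}
    (hq : IsPrimitiveRoot q d) (hd : Odd d) (u : K) :
    ∏ j ∈ Finset.range d, (X + C (u * q ^ j)) = X ^ d + C (u ^ d) := by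
  have h := X_pow_sub_C_eq_prod hq hd.pos (hd.neg_pow u)
  simpa [mul_comm] using h.symm

theorem heisA_sub_heisB_pow {ω : ℂ} {d k : ℕ} (hω : IsPrimitiveRoot (ω ^ k) d) (hd : Odd d)
    (r s : ℤ) :
    (heisA ω d r - heisB ω d k s) ^ d = (ω ^ (r * (d : ℤ)) - ω ^ (s * (d : ℤ))) • 1 := by
  obtain ⟨e, rfl⟩ : ∃ e, d = e + 1 := ⟨d - 1, by have := hd.pos; omega⟩
  have h := aeval_prod_X_add_C_eq_smul_one (heisA ω (e + 1) r - heisB ω (e + 1) k s)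
    (fun j => ω ^ s * (ω ^ k) ^ j) (ω ^ (r * ((e + 1 : ℕ) : ℤ))) ?_ ?_
  · rw [hω.prod_X_add_C_eq hd] at h
    simp only [map_add, map_pow, Polynomial.aeval_X, Polynomial.aeval_C] at h
    rw [sub_smul, ← h, _root_.zpow_mul, zpow_natCast, ← map_pow, Algebra.algebraMap_eq_smul_one,
      add_sub_cancel_right]
  · intro m hm
    rw [single_one_vecMul]
    ext j
    simp only [heisA, heisB, row_apply, Matrix.add_apply, Matrix.sub_apply, of_apply,
      Matrix.smul_apply, diagonal_apply, algebraMap_matrix_apply, Pi.single_apply, Fin.ext_iff,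
      Algebra.algebraMap_self, RingHom.id_apply, smul_eq_mul, pow_mul]
    grind
  · rw [single_one_vecMul]
    ext j
    simp only [heisA, heisB, row_apply, Matrix.add_apply, Matrix.sub_apply, of_apply,
      Matrix.smul_apply, diagonal_apply, algebraMap_matrix_apply, Pi.smul_apply,
      Pi.single_apply, Fin.ext_iff, Fin.val_last, Fin.val_zero, Algebra.algebraMap_self,
      RingHom.id_apply, smul_eq_mul, pow_mul]
    grind

/-- Let `n ≥ 1` be odd, `ω = exp(2πi/n)`, `k ∈ {0, …, n−1}`,
`d₁ = gcd(n, k)` (equal to `n` when `k = 0`), `d₂ = n/d₁`, and let `r, s ∈ ℤ`.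
With `Ā = heisA ω d₂ r` and `B̄ = heisB ω d₂ k s` one has
`(Ā − B̄)^n = −(ω^{(s−r)·d₂} − 1)^{d₁} · Id`; in particular `(Ā − B̄)^n` is a scalar
multiple of the identity matrix. -/
theorem heis_sub_pow_eq_scalar (n : ℕ) (hn : 1 ≤ n) (hodd : Odd n) (k : ℕ) (hk : k < n)
    (r s : ℤ) :
    (heisA (Complex.exp (2 * Real.pi * Complex.I / n)) (n / Nat.gcd n k) r -
        heisB (Complex.exp (2 * Real.pi * Complex.I / n)) (n / Nat.gcd n k) k s) ^ n
      = (-((Complex.exp (2 * Real.pi * Complex.I / n) ^ ((s - r) * ((n / Nat.gcd n k : ℕ) : ℤ))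
            - 1) ^ (Nat.gcd n k))) •
          (1 : Matrix (Fin (n / Nat.gcd n k)) (Fin (n / Nat.gcd n k)) ℂ) := by
  have hω := Complex.isPrimitiveRoot_exp n (by omega)
  set ω := Complex.exp (2 * Real.pi * Complex.I / n)
  have hmul : n / n.gcd k * n.gcd k = n := Nat.div_mul_cancel (Nat.gcd_dvd_left n k)
  have hodd' : Odd (n / n.gcd k * n.gcd k) := by rwa [hmul]
  obtain ⟨hd₂, hd₁⟩ := Nat.odd_mul.mp hodd'
  have hprim : IsPrimitiveRoot (ω ^ k) (n / n.gcd k) := by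
    rw [IsPrimitiveRoot.iff_orderOf,
      (isOfFinOrder_iff_pow_eq_one.mpr ⟨n, hn, hω.pow_eq_one⟩).orderOf_pow, ← hω.eq_orderOf]
  have hone : (ω ^ (r * ((n / n.gcd k : ℕ) : ℤ))) ^ n.gcd k = 1 := by
    rw [← zpow_natCast, ← _root_.zpow_mul, mul_assoc, ← Nat.cast_mul, hmul, mul_comm, _root_.zpow_mul,
      zpow_natCast, hω.pow_eq_one, _root_.one_zpow]
  have hfactor : ω ^ (r * ((n / n.gcd k : ℕ) : ℤ)) - ω ^ (s * ((n / n.gcd k : ℕ) : ℤ)) =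
      ω ^ (r * ((n / n.gcd k : ℕ) : ℤ)) * -(ω ^ ((s - r) * ((n / n.gcd k : ℕ) : ℤ)) - 1) := by
    rw [neg_sub, mul_sub, mul_one, ← zpow_add₀ (Complex.exp_ne_zero _), ← add_mul,
      add_sub_cancel]
  calc
    _ = ((heisA ω (n / n.gcd k) r - heisB ω (n / n.gcd k) k s) ^ (n / n.gcd k)) ^ n.gcd k := by
      rw [← pow_mul, hmul]
    _ = _ := by
      rw [heisA_sub_heisB_pow hprim hd₂, smul_pow, one_pow, hfactor, mul_pow, hone, one_mul,
        hd₁.neg_pow]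
end

section
/- Let n ≥ 1 be odd, ω = exp(2πi/n), k ∈ {0, 1, …, n−1}, d₁ = gcd(n, k) (interpreted as n when k = 0), d₂ = n/d₁, and let r, s ∈ {0, 1, …, d₁−1}. Let Ā ∈ Mat_{d₂}(ℂ) be the matrix with entries Ā_{i,i+1} = 1 for 1 ≤ i < d₂, Ā_{d₂,1} = ω^{r·d₂}, and all other entries 0, and let B̄ = ω^s · diag(1, ω^k, ω^{2k}, …, ω^{(d₂−1)k}) ∈ Mat_{d₂}(ℂ). Then the matrix Ā − B̄ is nilpotent if and only if r = s. Moreover, if r ≠ s then Ā − B̄ is invertible (all its eigenvalues are nonzero), while if r = s then 0 is its only eigenvalue. -/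
open Matrix

open Polynomial in
/-- A complex matrix with no nonzero eigenvalue is nilpotent. -/
theorem Matrix.isNilpotent_of_spectrum_subset {ι : Type*} [Fintype ι] [DecidableEq ι]
    {M : Matrix ι ι ℂ} (h : spectrum ℂ M ⊆ {0}) : IsNilpotent M := by
  have hroots : M.charpoly.roots = Multiset.replicate (Multiset.card M.charpoly.roots) 0 :=
    Multiset.eq_replicate_card.2 fun b hb =>
      h (Matrix.mem_spectrum_of_isRoot_charpoly (isRoot_of_mem_roots hb))
  have hsplit := (IsAlgClosed.splits M.charpoly).eq_prod_roots_of_monic M.charpoly_monic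
  rw [hroots] at hsplit
  refine ⟨Multiset.card M.charpoly.roots, ?_⟩
  have hM := M.aeval_self_charpoly
  rw [hsplit] at hM
  simpa using hM

theorem IsPrimitiveRoot.prod_fin_add_mul_pow {q : ℂ} {d : ℕ} (hq : IsPrimitiveRoot q d)
    (hd : Odd d) (x y : ℂ) : ∏ j : Fin d, (x + y * q ^ (j : ℕ)) = x ^ d + y ^ d := by
  rw [hq.pow_add_pow_eq_prod_add_mul x y hd, Fin.prod_univ_eq_prod_range (fun j => x + y * q ^ j)]
  refine Finset.prod_bij (fun j _ => q ^ j) ?_ ?_ ?_ ?_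
  · intro j _
    rw [Polynomial.mem_nthRootsFinset hd.pos, ← pow_mul, mul_comm, pow_mul, hq.pow_eq_one, one_pow]
  · intro i hi j hj
    exact hq.pow_inj (Finset.mem_range.1 hi) (Finset.mem_range.1 hj)
  · intro z hz
    have : NeZero d := ⟨hd.pos.ne'⟩
    obtain ⟨i, hi, h⟩ := hq.eq_pow_of_pow_eq_one ((Polynomial.mem_nthRootsFinset hd.pos 1).1 hz)
    exact ⟨i, Finset.mem_range.2 hi, h⟩
  · intro j _
    ring

theorem heisA_mulVec_castSucc (ω : ℂ) (m : ℕ) (r : ℤ) (v : Fin (m + 1) → ℂ) (i : Fin m) :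
    (heisA ω (m + 1) r *ᵥ v) i.castSucc = v i.succ := by
  rw [Matrix.mulVec, dotProduct, Finset.sum_eq_single i.succ]
  · simp [heisA]
  · intro j _ hj
    have h₁ : (i : ℕ) + 1 ≠ j := fun h => hj (Fin.ext (by simp [h]))
    simp [heisA, h₁, i.isLt.ne]
  · simp

theorem heisA_mulVec_last (ω : ℂ) (m : ℕ) (r : ℤ) (v : Fin (m + 1) → ℂ) :
    (heisA ω (m + 1) r *ᵥ v) (Fin.last m) = ω ^ (r * ((m + 1 : ℕ) : ℤ)) * v 0 := by
  rw [Matrix.mulVec, dotProduct, Finset.sum_eq_single 0]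
  · simp [heisA]
  · intro j _ hj
    have h₁ : m + 1 ≠ j := j.isLt.ne'
    simp [heisA, h₁, hj]
  · simp

theorem heisB_mulVec (ω : ℂ) (d k : ℕ) (s : ℤ) (v : Fin d → ℂ) (i : Fin d) :
    (heisB ω d k s *ᵥ v) i = ω ^ s * (ω ^ k) ^ (i : ℕ) * v i := by
  simp [heisB, Matrix.smul_mulVec, Matrix.mulVec_diagonal, pow_mul, mul_assoc]

/-- An eigenvector of `Ā - B̄` satisfies a first-order recursion which, after one full turn,
determines the `d`-th power of its eigenvalue. -/
theorem pow_eq_of_mem_spectrum_heis_sub {ω : ℂ} {d k : ℕ} {r s : ℤ} (hd : Odd d)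
    (hq : IsPrimitiveRoot (ω ^ k) d) {μ : ℂ}
    (hμ : μ ∈ spectrum ℂ (heisA ω d r - heisB ω d k s)) :
    μ ^ d = ω ^ (r * (d : ℤ)) - ω ^ (s * (d : ℤ)) := by
  obtain ⟨m, rfl⟩ : ∃ m, d = m + 1 := ⟨d - 1, (Nat.sub_add_cancel hd.pos).symm⟩
  rw [spectrum.mem_iff, Matrix.isUnit_iff_isUnit_det, isUnit_iff_ne_zero, not_not,
    ← Matrix.exists_mulVec_eq_zero_iff] at hμ
  obtain ⟨v, hv, hμv⟩ := hμ
  have hrow (i : Fin (m + 1)) :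
      (heisA ω (m + 1) r *ᵥ v) i = (μ + ω ^ s * (ω ^ k) ^ (i : ℕ)) * v i := by
    have h := congrFun hμv i
    rw [Matrix.sub_mulVec, Matrix.sub_mulVec, Pi.sub_apply, Pi.sub_apply, heisB_mulVec,
      Matrix.algebraMap_eq_diagonal, Matrix.mulVec_diagonal] at h
    simp only [Pi.algebraMap_apply, Algebra.algebraMap_self, RingHom.id_apply, Pi.zero_apply] at h
    linear_combination -h
  have hprod (j : ℕ) (hj : j < m + 1) :
      v ⟨j, hj⟩ = (∏ i ∈ Finset.range j, (μ + ω ^ s * (ω ^ k) ^ i)) * v 0 := by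
    induction j with
    | zero => simp
    | succ j ih =>
      have h := hrow (Fin.castSucc ⟨j, Nat.lt_of_succ_lt_succ hj⟩)
      rw [heisA_mulVec_castSucc] at h
      rw [Finset.prod_range_succ, mul_right_comm, ← ih (Nat.lt_of_succ_lt hj), mul_comm]
      exact h
  have hv0 : v 0 ≠ 0 := fun h => hv (funext fun j => by simpa [h] using hprod j j.isLt)
  have hlast := hrow (Fin.last m)
  rw [heisA_mulVec_last, show v (Fin.last m) = _ from hprod m m.lt_succ_self, ← mul_assoc,
    Fin.val_last, mul_comm (μ + _), ← Finset.prod_range_succ] at hlast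
  have h := mul_right_cancel₀ hv0 hlast
  rw [← Fin.prod_univ_eq_prod_range (fun i => μ + ω ^ s * (ω ^ k) ^ i),
    hq.prod_fin_add_mul_pow hd, ← zpow_natCast (ω ^ s), ← _root_.zpow_mul] at h
  exact eq_sub_of_add_eq h.symm

/-- Let `n ≥ 1` be odd, `ω = exp(2πi/n)`, `k ∈ {0, …, n−1}`,
`d₁ = gcd(n, k)` (equal to `n` when `k = 0`), `d₂ = n/d₁`, and let
`r, s ∈ {0, …, d₁−1}`.  With `Ā = heisA ω d₂ r` and `B̄ = heisB ω d₂ k s`, the matrix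
`Ā − B̄` is nilpotent if and only if `r = s`.  Moreover, if `r ≠ s` then `Ā − B̄` is
invertible (all its eigenvalues are nonzero), while if `r = s` then `0` is its only
eigenvalue (its spectrum is `{0}`). -/
theorem heis_sub_nilpotent_iff (n : ℕ) (hn : 1 ≤ n) (hodd : Odd n) (k : ℕ) (hk : k < n)
    (r s : ℤ) (hr : 0 ≤ r ∧ r < Nat.gcd n k) (hs : 0 ≤ s ∧ s < Nat.gcd n k) :
    (IsNilpotent
        (heisA (Complex.exp (2 * Real.pi * Complex.I / n)) (n / Nat.gcd n k) r -
          heisB (Complex.exp (2 * Real.pi * Complex.I / n)) (n / Nat.gcd n k) k s)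
      ↔ r = s) ∧
    (r ≠ s → IsUnit
        (heisA (Complex.exp (2 * Real.pi * Complex.I / n)) (n / Nat.gcd n k) r -
          heisB (Complex.exp (2 * Real.pi * Complex.I / n)) (n / Nat.gcd n k) k s)) ∧
    (r = s → spectrum ℂ
        (heisA (Complex.exp (2 * Real.pi * Complex.I / n)) (n / Nat.gcd n k) r -
          heisB (Complex.exp (2 * Real.pi * Complex.I / n)) (n / Nat.gcd n k) k s)
      = {0}) := by
  set ω := Complex.exp (2 * Real.pi * Complex.I / n)
  set d := n / Nat.gcd n k with hd_def
  have hω : IsPrimitiveRoot ω n := Complex.isPrimitiveRoot_exp n (by lia)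
  have hg : 0 < Nat.gcd n k := Nat.gcd_pos_of_pos_left k hn
  have hgd : Nat.gcd n k * d = n := Nat.mul_div_cancel' (Nat.gcd_dvd_left n k)
  have hd : Odd d := (Nat.odd_mul.1 (hgd.symm ▸ hodd)).2
  have : NeZero d := ⟨hd.pos.ne'⟩
  have hq : IsPrimitiveRoot (ω ^ k) d := by
    have hgk : Nat.gcd n k * (k / Nat.gcd n k) = k := Nat.mul_div_cancel' (Nat.gcd_dvd_right n k)
    have h := (hω.pow hn hgd.symm).pow_of_coprime (k / Nat.gcd n k)
      (Nat.coprime_div_gcd_div_gcd hg).symm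
    rwa [← pow_mul, hgk] at h
  have hrs : ω ^ (r * (d : ℤ)) = ω ^ (s * (d : ℤ)) → r = s := by
    intro h
    have hω0 : ω ≠ 0 := Complex.exp_ne_zero _
    have h1 : ω ^ ((r - s) * (d : ℤ)) = 1 := by
      rw [sub_mul, zpow_sub₀ hω0, h, div_self (zpow_ne_zero _ hω0)]
    have h2 : ((Nat.gcd n k : ℕ) : ℤ) * d ∣ (r - s) * d := by
      rw [hω.zpow_eq_one_iff_dvd] at h1
      exact_mod_cast hgd.symm ▸ h1
    have h3 := Int.dvd_of_mul_dvd_mul_right (by exact_mod_cast hd.pos.ne') h2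
    exact sub_eq_zero.1 (Int.eq_zero_of_abs_lt_dvd h3 (abs_lt.2 ⟨by lia, by lia⟩))
  have hunit (h : r ≠ s) : IsUnit (heisA ω d r - heisB ω d k s) := by
    rw [← spectrum.zero_notMem_iff ℂ]
    intro h0
    have := pow_eq_of_mem_spectrum_heis_sub hd hq h0
    rw [zero_pow hd.pos.ne'] at this
    exact h (hrs (sub_eq_zero.1 this.symm))
  have hspec (h : r = s) : spectrum ℂ (heisA ω d r - heisB ω d k s) ⊆ {0} := by
    intro μ hμ
    have := pow_eq_of_mem_spectrum_heis_sub hd hq hμ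
    rw [h, sub_self] at this
    exact eq_zero_of_pow_eq_zero this
  refine ⟨⟨fun hnil => ?_, fun h => Matrix.isNilpotent_of_spectrum_subset (hspec h)⟩, hunit,
    fun h => (spectrum.nonempty_of_isAlgClosed_of_finiteDimensional ℂ _).subset_singleton_iff.1
      (hspec h)⟩
  by_contra h
  exact (hunit h).not_isNilpotent hnil
end
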